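/- The maximum departure region of the two-user broadcast channel with decoding costs, D := { (B₁,B₂) ∈ ℝ² : there exists a feasible rate policy (r₁,r₂) with B₁ ≤ ∑_{i=1}^N r_{1i} and B₂ ≤ ∑_{i=1}^N r_{2i} }, is a convex subset of ℝ². -/

import Mathlib

open Finset

/-- Minimum transmit power needed to deliver rates `r1` (strong user) and `r2`
(weak user) on the degraded Gaussian BC with noise variances `1` and `σ2 > 1`. -/
noncomputable def Fmin (σ2 r1 r2 : ℝ) : ℝ :=
  (σ2 - 1) * (2 : ℝ) ^ (2 * r2) + (2 : ℝ) ^ (2 * (r1 + r2)) - σ2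

/-- Feasibility of a rate policy `(r1, r2)` for the two-user degraded BC with
transmitter energies `E`, strong-receiver energies `Eb1` and weak-receiver
energies `Eb2` (decoding cost `φ(r) = 2^{2r} − 1`). -/
def BCFeasible (N : ℕ) (σ2 : ℝ) (E Eb1 Eb2 : ℕ → ℝ) (r1 r2 : ℕ → ℝ) : Prop :=
  (∀ i ∈ Finset.Icc 1 N, 0 ≤ r1 i) ∧
  (∀ i ∈ Finset.Icc 1 N, 0 ≤ r2 i) ∧
  (∀ k ∈ Finset.Icc 1 N,
      ∑ i ∈ Finset.Icc 1 k, Fmin σ2 (r1 i) (r2 i) ≤ ∑ i ∈ Finset.Icc 1 k, E i) ∧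
  (∀ k ∈ Finset.Icc 1 N,
      ∑ i ∈ Finset.Icc 1 k, ((2 : ℝ) ^ (2 * (r1 i + r2 i)) - 1) ≤
        ∑ i ∈ Finset.Icc 1 k, Eb1 i) ∧
  (∀ k ∈ Finset.Icc 1 N,
      ∑ i ∈ Finset.Icc 1 k, ((2 : ℝ) ^ (2 * r2 i) - 1) ≤
        ∑ i ∈ Finset.Icc 1 k, Eb2 i)

theorem two_rpow_convex_aux (x y a b : ℝ) (ha : 0 ≤ a) (hb : 0 ≤ b) (hab : a + b = 1) :
    (2 : ℝ) ^ (2 * (a * x + b * y)) ≤ a * (2 : ℝ) ^ (2 * x) + b * (2 : ℝ) ^ (2 * y) := by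
  have h := convexOn_exp.2 (Set.mem_univ (Real.log 2 * (2 * x)))
    (Set.mem_univ (Real.log 2 * (2 * y))) ha hb hab
  simp only [smul_eq_mul] at h
  rw [Real.rpow_def_of_pos two_pos, Real.rpow_def_of_pos two_pos, Real.rpow_def_of_pos two_pos]
  refine le_trans (le_of_eq ?_) h
  congr 1
  ring

theorem sum_convex_aux (s : Finset ℕ) (f g h : ℕ → ℝ) (S a b : ℝ) (ha : 0 ≤ a) (hb : 0 ≤ b)
    (hab : a + b = 1) (hg : ∀ i, g i ≤ a * f i + b * h i)
    (hf : ∑ i ∈ s, f i ≤ S) (hh : ∑ i ∈ s, h i ≤ S) : ∑ i ∈ s, g i ≤ S := by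
  calc ∑ i ∈ s, g i ≤ ∑ i ∈ s, (a * f i + b * h i) := Finset.sum_le_sum fun i _ => hg i
    _ = a * ∑ i ∈ s, f i + b * ∑ i ∈ s, h i := by
      rw [Finset.sum_add_distrib, Finset.mul_sum, Finset.mul_sum]
    _ ≤ a * S + b * S :=
      add_le_add (mul_le_mul_of_nonneg_left hf ha) (mul_le_mul_of_nonneg_left hh hb)
    _ = S := by rw [← add_mul, hab, one_mul]

/-- the maximum departure region of the two-user BC with decoding costs
is a convex subset of `ℝ²`. -/
theorem bc_departure_region_convex
    (N : ℕ) (hN : 1 ≤ N)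
    (σ2 : ℝ) (hσ2 : 1 < σ2)
    (E Eb1 Eb2 : ℕ → ℝ)
    (hE : ∀ i ∈ Finset.Icc 1 N, 0 ≤ E i)
    (hEb1 : ∀ i ∈ Finset.Icc 1 N, 0 ≤ Eb1 i)
    (hEb2 : ∀ i ∈ Finset.Icc 1 N, 0 ≤ Eb2 i) :
    Convex ℝ
      {B : ℝ × ℝ | ∃ r1 r2 : ℕ → ℝ, BCFeasible N σ2 E Eb1 Eb2 r1 r2 ∧
        B.1 ≤ ∑ i ∈ Finset.Icc 1 N, r1 i ∧
        B.2 ≤ ∑ i ∈ Finset.Icc 1 N, r2 i} := by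
  rintro ⟨x1, x2⟩ ⟨r1, r2, ⟨p1, p2, pE, pA, pB⟩, hx1, hx2⟩ ⟨y1, y2⟩
    ⟨s1, s2, ⟨q1, q2, qE, qA, qB⟩, hy1, hy2⟩ a b ha hb hab
  have key2 : ∀ i, (2 : ℝ) ^ (2 * (a * r2 i + b * s2 i)) ≤
      a * (2 : ℝ) ^ (2 * r2 i) + b * (2 : ℝ) ^ (2 * s2 i) :=
    fun i => two_rpow_convex_aux _ _ a b ha hb hab
  have key1 : ∀ i, (2 : ℝ) ^ (2 * ((a * r1 i + b * s1 i) + (a * r2 i + b * s2 i))) ≤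
      a * (2 : ℝ) ^ (2 * (r1 i + r2 i)) + b * (2 : ℝ) ^ (2 * (s1 i + s2 i)) := by
    intro i
    refine le_trans (le_of_eq ?_) (two_rpow_convex_aux _ _ a b ha hb hab)
    congr 1
    ring
  have hb' : b = 1 - a := by linarith
  refine ⟨fun i => a * r1 i + b * s1 i, fun i => a * r2 i + b * s2 i,
    ⟨fun i hi => ?_, fun i hi => ?_, fun k hk => ?_, fun k hk => ?_, fun k hk => ?_⟩, ?_, ?_⟩
  · exact add_nonneg (mul_nonneg ha (p1 i hi)) (mul_nonneg hb (q1 i hi))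
  · exact add_nonneg (mul_nonneg ha (p2 i hi)) (mul_nonneg hb (q2 i hi))
  · refine sum_convex_aux _ _ _ _ _ a b ha hb hab (fun i => ?_) (pE k hk) (qE k hk)
    simp only [Fmin]
    have h2 := mul_le_mul_of_nonneg_left (key2 i) (sub_nonneg.2 hσ2.le)
    have h3 : a * σ2 + b * σ2 = σ2 := by rw [← add_mul, hab, one_mul]
    linarith [key1 i]
  · refine sum_convex_aux _ _ _ _ _ a b ha hb hab (fun i => ?_) (pA k hk) (qA k hk)
    linarith [key1 i]
  · refine sum_convex_aux _ _ _ _ _ a b ha hb hab (fun i => ?_) (pB k hk) (qB k hk)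
    linarith [key2 i]
  · simp only [Prod.smul_mk, Prod.mk_add_mk, smul_eq_mul, Finset.sum_add_distrib,
      ← Finset.mul_sum]
    exact add_le_add (mul_le_mul_of_nonneg_left hx1 ha) (mul_le_mul_of_nonneg_left hy1 hb)
  · simp only [Prod.smul_mk, Prod.mk_add_mk, smul_eq_mul, Finset.sum_add_distrib,
      ← Finset.mul_sum]
    exact add_le_add (mul_le_mul_of_nonneg_left hx2 ha) (mul_le_mul_of_nonneg_left hy2 hb)
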